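/- arXiv:1902.07163 — 2 statements merged into one kernel-verified Lean document; each statement's English description precedes it below -/
import Mathlib

section
/- For any 2×2 real symmetric matrix N and any 2×2 real matrix T, the complex matrix C(T,N) is Hermitian, its trace equals trace N, and its determinant equals det N − (1 − det T)². -/
open Matrix Complex

/-- The one-mode symplectic form `Ω = !![0, 1; -1, 0]`. -/
noncomputable def Omega : Matrix (Fin 2) (Fin 2) ℝ := !![0, 1; -1, 0]

/-- The complete-positivity matrix `C(T,N) = N + i·Ω − i·T·Ω·Tᵀ`, real matrices viewed as
complex via the canonical embedding. -/
noncomputable def Cmat (T N : Matrix (Fin 2) (Fin 2) ℝ) : Matrix (Fin 2) (Fin 2) ℂ :=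
  N.map (fun x => (x : ℂ)) + Complex.I • (Omega.map (fun x => (x : ℂ)))
    - Complex.I • ((T * Omega * Tᵀ).map (fun x => (x : ℂ)))

/-- For `2 × 2` matrices, `T Ω Tᵀ = (det T) Ω`. -/
lemma mul_Omega_mul_transpose (T : Matrix (Fin 2) (Fin 2) ℝ) :
    T * Omega * Tᵀ = T.det • Omega := by
  ext i j
  fin_cases i <;> fin_cases j <;>
    simp [Omega, Matrix.mul_apply, Fin.sum_univ_two, Matrix.det_fin_two] <;> ring

lemma Cmat_eq (T N : Matrix (Fin 2) (Fin 2) ℝ) (hN : N.IsSymm) :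
    Cmat T N = !![(N 0 0 : ℂ), N 0 1 + I * (1 - T.det);
      N 0 1 - I * (1 - T.det), (N 1 1 : ℂ)] := by
  rw [Cmat, mul_Omega_mul_transpose]
  ext i j
  fin_cases i <;> fin_cases j <;> simp [Omega, hN.apply 0 1] <;> ring

/-- For any 2×2 real symmetric `N` and any 2×2 real `T`, `C(T,N)` is Hermitian, its trace
equals `trace N`, and its determinant equals `det N − (1 − det T)²`. -/
theorem stmt_1 (T N : Matrix (Fin 2) (Fin 2) ℝ) (hN : N.IsSymm) :
    (Cmat T N).IsHermitian ∧ (Cmat T N).trace = (N.trace : ℂ) ∧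
      (Cmat T N).det = ((N.det - (1 - T.det) ^ 2 : ℝ) : ℂ) := by
  rw [Cmat_eq T N hN]
  refine ⟨?_, ?_, ?_⟩
  · ext i j
    fin_cases i <;> fin_cases j <;> simp [Matrix.conjTranspose_apply, sub_eq_add_neg]
  · simp [Matrix.trace_fin_two]
  · rw [Matrix.det_fin_two_of, Matrix.det_fin_two N, hN.apply 0 1]
    push_cast
    linear_combination (1 - (T.det : ℂ)) ^ 2 * I_sq
end

section
/- For real parameters with b3 ≠ 0 and b2 = 0, the matrix T_G has rank exactly 1. In particular, T_G never has rank 0, so a Gaussian channel with Gaussian functional form is never a total depolarizing channel (class A₁): every singular Gaussian-form channel belongs to class A₂ (rank T = 1). -/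
open Matrix

namespace Matrix

theorem rank_ne_zero_of_apply_ne_zero {m n K : Type*} [Fintype n] [Field K]
    {A : Matrix m n K} {i : m} {j : n} (h : A i j ≠ 0) : A.rank ≠ 0 := by
  classical
  intro hA
  rw [rank, Submodule.finrank_eq_zero, LinearMap.range_eq_bot] at hA
  have hcol := congrFun (LinearMap.congr_fun hA (Pi.single j 1)) i
  exact h (by simpa using hcol)

end Matrix

/-- For real parameters with `b3 ≠ 0` and `b2 = 0`, the matrix
`T_G = !![-b4/b3, 1/b3; b1·b4/b3 - b2, -b1/b3]` has rank exactly 1; moreover `T_G` never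
has rank 0, so a Gaussian channel with Gaussian functional form is never in class `A₁`:
every singular Gaussian-form channel belongs to class `A₂`. -/
theorem stmt_7 (b1 b2 b3 b4 : ℝ) (hb3 : b3 ≠ 0) :
    (b2 = 0 →
      (!![-b4 / b3, 1 / b3; b1 * b4 / b3 - b2, -b1 / b3] : Matrix (Fin 2) (Fin 2) ℝ).rank = 1) ∧
    (!![-b4 / b3, 1 / b3; b1 * b4 / b3 - b2, -b1 / b3] : Matrix (Fin 2) (Fin 2) ℝ).rank ≠ 0 := by
  have hne : (!![-b4 / b3, 1 / b3; b1 * b4 / b3 - b2, -b1 / b3] :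
      Matrix (Fin 2) (Fin 2) ℝ).rank ≠ 0 :=
    rank_ne_zero_of_apply_ne_zero (i := 0) (j := 1) (by simpa using hb3)
  refine ⟨fun hb2 => ?_, hne⟩
  have hfactor : (!![-b4 / b3, 1 / b3; b1 * b4 / b3 - b2, -b1 / b3] :
      Matrix (Fin 2) (Fin 2) ℝ) = vecMulVec ![1, -b1] ![-b4 / b3, 1 / b3] := by
    ext i j
    fin_cases i <;> fin_cases j <;> simp [vecMulVec_apply, hb2] <;> ring
  refine le_antisymm ?_ (Nat.one_le_iff_ne_zero.mpr hne)
  rw [hfactor]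
  exact rank_vecMulVec_le _ _
end
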